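/- Let R ∈ SO(2) be a rotation such that ℤ² ∩ Rℤ² = {0}. Then the autocorrelation of ω = ½(δ_{ℤ²} + δ_{Rℤ²}) is γ_ω = ¼δ_{ℤ²} + ¼δ_{Rℤ²} + ½λ, where λ is Lebesgue measure on ℝ². Consequently the diffraction measure is γ̂_ω = Σ_{x ∈ ℤ² ∪ Rℤ²} I(x) δ_x with I(0) = 1 and I(x) = ¼ for all x ≠ 0 in ℤ² ∪ Rℤ². -/

import Mathlib

open MeasureTheory Real Filter
open scoped FourierTransform ENNReal

/-- The point of `ℂ` corresponding to `p ∈ ℤ²`. -/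
noncomputable def latPt (p : ℤ × ℤ) : ℂ := (p.1 : ℂ) + (p.2 : ℂ) * Complex.I

/-- The Dirac comb of the rotated square lattice `u·ℤ²` (for `|u| = 1`). -/
noncomputable def rotLatticeComb (u : ℂ) : Measure ℂ :=
  Measure.sum fun p : ℤ × ℤ => Measure.dirac (u * latPt p)

/-- `HasLatticeDecay C f` says that `f` is dominated by `C / ((1 + x²)(1 + y²))`. -/
def HasLatticeDecay (C : ℝ) (f : ℂ → ℂ) : Prop :=
  ∀ z : ℂ, ‖f z‖ ≤ C * ((1 + z.re ^ 2)⁻¹ * (1 + z.im ^ 2)⁻¹)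

theorem latPt_re (p : ℤ × ℤ) : (latPt p).re = p.1 := by simp [latPt]

theorem latPt_im (p : ℤ × ℤ) : (latPt p).im = p.2 := by simp [latPt]

theorem latPt_eq_mk (p : ℤ × ℤ) : latPt p = ⟨p.1, p.2⟩ :=
  Complex.ext (latPt_re p) (latPt_im p)

theorem summable_int_inv_one_add_sq : Summable fun n : ℤ => (1 + (n : ℝ) ^ 2)⁻¹ := by
  refine Summable.of_norm_bounded_eventually
    (g := fun n : ℤ => |(n : ℝ)| ^ (-2 : ℝ)) (Real.summable_abs_int_rpow one_lt_two) ?_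
  filter_upwards [(Set.finite_singleton (0 : ℤ)).compl_mem_cofinite] with n hn
  have hn' : (0 : ℝ) < |(n : ℝ)| := abs_pos.2 (Int.cast_ne_zero.2 hn)
  rw [Real.norm_of_nonneg (by positivity), Real.rpow_neg hn'.le, Real.rpow_two, sq_abs]
  have : (0 : ℝ) < (n : ℝ) ^ 2 := by rw [← sq_abs]; positivity
  gcongr
  linarith

theorem summable_lattice_weight :
    Summable fun p : ℤ × ℤ => (1 + (p.1 : ℝ) ^ 2)⁻¹ * (1 + (p.2 : ℝ) ^ 2)⁻¹ :=
  summable_int_inv_one_add_sq.mul_of_nonneg summable_int_inv_one_add_sq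
    (fun _ => by positivity) (fun _ => by positivity)

theorem HasLatticeDecay.summable {C : ℝ} {f : ℂ → ℂ} (hf : HasLatticeDecay C f) :
    Summable fun p : ℤ × ℤ => f (latPt p) := by
  refine Summable.of_norm_bounded (summable_lattice_weight.mul_left C) fun p => ?_
  simpa [latPt_re, latPt_im] using hf (latPt p)

theorem isBigO_cocompact_of_le_inv_one_add_sq {C : ℝ} {f : ℝ → ℂ}
    (hf : ∀ x, ‖f x‖ ≤ C * (1 + x ^ 2)⁻¹) :
    f =O[cocompact ℝ] fun x : ℝ => |x| ^ (-2 : ℝ) := by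
  have hC : 0 ≤ C := by simpa using (norm_nonneg _).trans (hf 0)
  refine Asymptotics.IsBigO.of_bound C ?_
  have h0 : ∀ᶠ x : ℝ in cocompact ℝ, x ∈ ({0} : Set ℝ)ᶜ :=
    isCompact_singleton.compl_mem_cocompact
  filter_upwards [h0] with x hx
  have hx' : (0 : ℝ) < |x| := abs_pos.2 hx
  refine (hf x).trans ?_
  rw [Real.norm_of_nonneg (by positivity), Real.rpow_neg hx'.le, Real.rpow_two, sq_abs]
  have : (0 : ℝ) < x ^ 2 := by rw [← sq_abs]; positivity
  gcongr
  linarith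

theorem poisson_one_dim {C : ℝ} {f : ℝ → ℂ} (hc : Continuous f)
    (hf : ∀ x, ‖f x‖ ≤ C * (1 + x ^ 2)⁻¹) (hF : Summable fun n : ℤ => 𝓕 f (n : ℝ)) :
    ∑' n : ℤ, f n = ∑' n : ℤ, 𝓕 f (n : ℝ) := by
  simpa using Real.tsum_eq_tsum_fourier_of_rpow_decay_of_summable hc one_lt_two
    (isBigO_cocompact_of_le_inv_one_add_sq hf) hF 0

theorem fourier_mk_eq_iterated {C : ℝ} {f : ℂ → ℂ} (hc : Continuous f)
    (hf : HasLatticeDecay C f) (a b : ℝ) :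
    𝓕 f (⟨a, b⟩ : ℂ) = 𝓕 (fun x : ℝ => 𝓕 (fun y : ℝ => f ⟨x, y⟩) b) a := by
  have hmk : Continuous fun p : ℝ × ℝ => (⟨p.1, p.2⟩ : ℂ) :=
    Complex.equivRealProdCLM.symm.continuous
  rw [Real.fourier_eq,
    ← (Complex.volume_preserving_equiv_real_prod.symm).integral_comp
      Complex.measurableEquivRealProd.symm.measurableEmbedding]
  simp only [Complex.measurableEquivRealProd_symm_apply]
  rw [Measure.volume_eq_prod, integral_prod, Real.fourier_eq]
  · refine integral_congr_ae (Eventually.of_forall fun x => ?_)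
    simp only [Real.fourier_eq]
    rw [Circle.smul_def, ← integral_smul]
    refine integral_congr_ae (Eventually.of_forall fun y => ?_)
    have h : -inner ℝ (⟨x, y⟩ : ℂ) ⟨a, b⟩ = -inner ℝ x a + -inner ℝ y b := by
      simp [Complex.inner]
      ring
    simp only [h, AddChar.map_add_eq_mul, Circle.smul_def, Circle.coe_mul, smul_eq_mul, mul_assoc]
  · have hint : Integrable (fun p : ℝ × ℝ => C * ((1 + p.1 ^ 2)⁻¹ * (1 + p.2 ^ 2)⁻¹))
        ((volume : Measure ℝ).prod volume) :=
      (integrable_inv_one_add_sq.mul_prod integrable_inv_one_add_sq).const_mul C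
    refine hint.mono' ?_ (Eventually.of_forall fun p => ?_)
    · exact ((Real.continuous_fourierChar.comp (hmk.inner continuous_const).neg).smul
        (hc.comp hmk)).aestronglyMeasurable
    · simpa using hf ⟨p.1, p.2⟩

theorem HasLatticeDecay.tsum_eq_tsum_fourier {C D : ℝ} {f : ℂ → ℂ} (hc : Continuous f)
    (hf : HasLatticeDecay C f) (hF : HasLatticeDecay D (𝓕 f)) :
    ∑' p : ℤ × ℤ, f (latPt p) = ∑' p : ℤ × ℤ, 𝓕 f (latPt p) := by
  have hC : 0 ≤ C := by simpa using (norm_nonneg _).trans (hf 0)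
  have hmk : Continuous fun p : ℝ × ℝ => (⟨p.1, p.2⟩ : ℂ) :=
    Complex.equivRealProdCLM.symm.continuous
  have hb : ∀ x y : ℝ, ‖f ⟨x, y⟩‖ ≤ C * ((1 + x ^ 2)⁻¹ * (1 + y ^ 2)⁻¹) := fun x y => hf ⟨x, y⟩
  have hsum := hf.summable
  have hFsum := hF.summable
  set S : ℝ := ∑' n : ℤ, (1 + (n : ℝ) ^ 2)⁻¹ with hS
  set J : ℝ := ∫ y : ℝ, (1 + y ^ 2)⁻¹ with hJ
  have hw : ∀ y : ℝ, (1 + y ^ 2)⁻¹ ≤ 1 := fun y => inv_le_one_of_one_le₀ (by nlinarith [sq_nonneg y])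
  -- the partial Fourier transform in the second variable
  let k : ℤ → ℝ → ℂ := fun n x => 𝓕 (fun y : ℝ => f ⟨x, y⟩) n
  have hkc : ∀ n, Continuous (k n) := by
    intro n
    simp only [k, Real.fourier_eq]
    refine continuous_of_dominated (bound := fun y => C * (1 + y ^ 2)⁻¹) (fun x => ?_)
      (fun x => Eventually.of_forall fun y => ?_) (integrable_inv_one_add_sq.const_mul C)
      (Eventually.of_forall fun y => ?_)
    · exact ((Real.continuous_fourierChar.comp (continuous_id.inner continuous_const).neg).smul
        (hc.comp (hmk.comp (Continuous.prodMk_right x)))).aestronglyMeasurable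
    · rw [Circle.norm_smul]
      refine (hb x y).trans ?_
      gcongr
      exact mul_le_of_le_one_left (by positivity) (hw x)
    · exact (hc.comp (hmk.comp (Continuous.prodMk_left y))).const_smul _
  have hkb : ∀ n x, ‖k n x‖ ≤ (C * J) * (1 + x ^ 2)⁻¹ := by
    intro n x
    simp only [k, Real.fourier_eq]
    refine (norm_integral_le_of_norm_le
      (integrable_inv_one_add_sq.const_mul (C * (1 + x ^ 2)⁻¹))
      (Eventually.of_forall fun y => ?_)).trans_eq ?_
    · rw [Circle.norm_smul, mul_assoc]; exact hb x y
    · rw [integral_const_mul]; ring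
  have hkF : ∀ n m : ℤ, 𝓕 (k n) (m : ℝ) = 𝓕 f (latPt (m, n)) := by
    intro n m
    rw [latPt_eq_mk, fourier_mk_eq_iterated hc hf]
  have hkP : ∀ n, ∑' m : ℤ, k n m = ∑' m : ℤ, 𝓕 f (latPt (m, n)) := by
    intro n
    rw [poisson_one_dim (hkc n) (hkb n)]
    · simp_rw [hkF]
    · simp_rw [hkF]
      exact hFsum.prod_symm.prod_factor n
  -- the periodization in the first variable
  let G : ℝ → ℂ := fun y => ∑' m : ℤ, f ⟨m, y⟩
  have hGs : ∀ y : ℝ, Summable fun m : ℤ => C * ((1 + (m : ℝ) ^ 2)⁻¹ * (1 + y ^ 2)⁻¹) :=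
    fun y => (summable_int_inv_one_add_sq.mul_right _).mul_left C
  have hGc : Continuous G := by
    refine continuous_tsum (u := fun m : ℤ => C * (1 + (m : ℝ) ^ 2)⁻¹) (fun m => ?_)
      (summable_int_inv_one_add_sq.mul_left C) fun m y => ?_
    · exact hc.comp (hmk.comp (by fun_prop : Continuous fun y : ℝ => ((m : ℝ), y)))
    · refine (hb m y).trans ?_
      gcongr
      exact mul_le_of_le_one_right (by positivity) (hw y)
  have hGb : ∀ y, ‖G y‖ ≤ (C * S) * (1 + y ^ 2)⁻¹ := by
    intro y
    refine (tsum_of_norm_bounded (hGs y).hasSum fun m => hb m y).trans_eq ?_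
    rw [tsum_mul_left, tsum_mul_right, mul_assoc]
  have hGF : ∀ n : ℤ, 𝓕 G (n : ℝ) = ∑' m : ℤ, 𝓕 f (latPt (m, n)) := by
    intro n
    rw [← hkP n]
    simp only [k, Real.fourier_eq, G]
    refine (integral_congr_ae (Eventually.of_forall fun y : ℝ =>
        (tsum_const_smul'' (𝐞 (-inner ℝ y (n : ℝ)) : ℂ)
          (f := fun m : ℤ => f ⟨m, y⟩)).symm)).trans
      (integral_tsum_of_summable_integral_norm
        (F := fun (m : ℤ) (y : ℝ) => 𝐞 (-inner ℝ y (n : ℝ)) • f ⟨m, y⟩) ?_ ?_).symm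
    · intro m
      refine (integrable_inv_one_add_sq.const_mul (C * (1 + (m : ℝ) ^ 2)⁻¹)).mono' ?_
        (Eventually.of_forall fun y => ?_)
      · exact ((Real.continuous_fourierChar.comp (continuous_id.inner continuous_const).neg).smul
          (hc.comp (hmk.comp (Continuous.prodMk_right (m : ℝ))))).aestronglyMeasurable
      · rw [Circle.norm_smul, mul_assoc]; exact hb m y
    · refine Summable.of_nonneg_of_le (fun m => integral_nonneg fun y => norm_nonneg _) (fun m => ?_)
        ((summable_int_inv_one_add_sq.mul_left C).mul_right J)
      rw [hJ, ← integral_const_mul]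
      refine integral_mono_of_nonneg (Eventually.of_forall fun y => norm_nonneg _)
        (integrable_inv_one_add_sq.const_mul _) (Eventually.of_forall fun y => ?_)
      simp only [Circle.norm_smul]
      rw [mul_assoc]; exact hb m y
  have hGP : ∑' n : ℤ, G n = ∑' n : ℤ, 𝓕 G (n : ℝ) := by
    refine poisson_one_dim hGc hGb ?_
    simp_rw [hGF]
    exact hFsum.prod_symm.prod
  rw [← (Equiv.prodComm ℤ ℤ).tsum_eq, ← (Equiv.prodComm ℤ ℤ).tsum_eq (fun p => 𝓕 f (latPt p)),
    Summable.tsum_prod (f := fun p => f (latPt (Equiv.prodComm ℤ ℤ p)))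
      ((Equiv.prodComm ℤ ℤ).summable_iff.2 hsum),
    Summable.tsum_prod (f := fun p => 𝓕 f (latPt (Equiv.prodComm ℤ ℤ p)))
      ((Equiv.prodComm ℤ ℤ).summable_iff.2 hFsum)]
  simp_rw [hGF] at hGP
  simpa [G, latPt_eq_mk] using hGP

theorem SchwartzMap.exists_hasLatticeDecay (f : SchwartzMap ℂ ℂ) :
    ∃ C, HasLatticeDecay C f := by
  refine ⟨2 ^ 4 * (Finset.Iic (4, 0)).sup (fun m => SchwartzMap.seminorm ℝ m.1 m.2) f,
    fun z => ?_⟩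
  have h := SchwartzMap.one_add_le_sup_seminorm_apply (𝕜 := ℝ) (m := (4, 0)) (k := 4) (n := 0)
    le_rfl le_rfl f z
  rw [norm_iteratedFDeriv_zero] at h
  rw [← mul_inv, ← div_eq_mul_inv, le_div_iff₀ (by positivity), mul_comm]
  refine le_trans ?_ h
  gcongr
  have h1 : 1 + z.re ^ 2 ≤ (1 + ‖z‖) ^ 2 := by
    nlinarith [Complex.abs_re_le_norm z, abs_nonneg z.re, sq_abs z.re, norm_nonneg z]
  have h2 : 1 + z.im ^ 2 ≤ (1 + ‖z‖) ^ 2 := by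
    nlinarith [Complex.abs_im_le_norm z, abs_nonneg z.im, sq_abs z.im, norm_nonneg z]
  calc _ ≤ (1 + ‖z‖) ^ 2 * (1 + ‖z‖) ^ 2 := by gcongr
    _ = _ := by ring

theorem SchwartzMap.summable_latPt (f : SchwartzMap ℂ ℂ) :
    Summable fun p : ℤ × ℤ => f (latPt p) :=
  f.exists_hasLatticeDecay.choose_spec.summable

theorem SchwartzMap.summable_fourier_latPt (f : SchwartzMap ℂ ℂ) :
    Summable fun p : ℤ × ℤ => 𝓕 (f : ℂ → ℂ) (latPt p) :=
  (𝓕 f).summable_latPt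

/-- Poisson summation for the square lattice in the plane. -/
theorem SchwartzMap.tsum_latPt_eq_tsum_fourier (f : SchwartzMap ℂ ℂ) :
    ∑' p : ℤ × ℤ, f (latPt p) = ∑' p : ℤ × ℤ, 𝓕 (f : ℂ → ℂ) (latPt p) := by
  obtain ⟨C, hC⟩ := f.exists_hasLatticeDecay
  obtain ⟨D, hD⟩ := (𝓕 f).exists_hasLatticeDecay
  exact hC.tsum_eq_tsum_fourier f.continuous hD

/-- The lattice points of `ℤ²` in the open disc of radius `ρ` around the origin. -/
noncomputable def latBall (ρ : ℝ) : Finset (ℤ × ℤ) :=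
  {p ∈ Finset.Icc (-⌈ρ⌉, -⌈ρ⌉) (⌈ρ⌉, ⌈ρ⌉) | ‖latPt p‖ < ρ}

theorem mem_latBall {ρ : ℝ} {p : ℤ × ℤ} : p ∈ latBall ρ ↔ ‖latPt p‖ < ρ := by
  refine ⟨fun h => (Finset.mem_filter.1 h).2, fun h => Finset.mem_filter.2 ⟨?_, h⟩⟩
  have key : ∀ n : ℤ, |(n : ℝ)| ≤ ‖latPt p‖ → -⌈ρ⌉ ≤ n ∧ n ≤ ⌈ρ⌉ := by
    intro n hn
    have h1 : |(n : ℝ)| ≤ ⌈ρ⌉ := (hn.trans h.le).trans (Int.le_ceil ρ)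
    exact abs_le.1 (by exact_mod_cast h1)
  have h1 := key p.1 (by simpa [latPt_re] using Complex.abs_re_le_norm (latPt p))
  have h2 := key p.2 (by simpa [latPt_im] using Complex.abs_im_le_norm (latPt p))
  exact Finset.mem_Icc.2 ⟨⟨h1.1, h2.1⟩, ⟨h1.2, h2.2⟩⟩

theorem latBall_mono {ρ σ : ℝ} (h : ρ ≤ σ) : latBall ρ ⊆ latBall σ :=
  fun _ hp => mem_latBall.2 ((mem_latBall.1 hp).trans_le h)

theorem latPt_add (p q : ℤ × ℤ) : latPt (p + q) = latPt p + latPt q := by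
  simp [latPt]; ring

theorem latPt_sub (p q : ℤ × ℤ) : latPt (p - q) = latPt p - latPt q := by
  simp [latPt]; ring

theorem latPt_injective : Function.Injective latPt := fun p q h => by
  have h1 := congrArg Complex.re h
  have h2 := congrArg Complex.im h
  simp only [latPt_re, latPt_im, Int.cast_inj] at h1 h2
  exact Prod.ext h1 h2

theorem latPt_zero : latPt 0 = 0 := by simp [latPt]

open scoped Pointwise in
theorem tendsto_card_latBall_div_sq :
    Tendsto (fun ρ : ℝ => ((latBall ρ).card : ℝ) / ρ ^ 2) atTop (nhds π) := by
  let Φ : ℂ ≃ₜ (Fin 2 → ℝ) := Complex.basisOneI.equivFun.toContinuousLinearEquiv.toHomeomorph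
  have hΦ : MeasurePreserving Φ.symm volume volume := Complex.volume_preserving_equiv_pi.symm
  have hΦs : ∀ x : Fin 2 → ℝ, Φ.symm x = (x 0 : ℂ) + (x 1 : ℂ) * Complex.I := fun x =>
    Complex.measurableEquivPi_symm_apply x
  have hΦsmul : ∀ (c : ℝ) (x : Fin 2 → ℝ), Φ.symm (c • x) = (c : ℂ) * Φ.symm x := by
    intro c x
    simp only [hΦs, Pi.smul_apply, smul_eq_mul, Complex.ofReal_mul]
    ring
  let s : Set (Fin 2 → ℝ) := Φ.symm ⁻¹' Metric.ball 0 1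
  have hmem : ∀ x, x ∈ s ↔ ‖Φ.symm x‖ < 1 := fun x => by simp [s]
  have hs1 : Bornology.IsBounded s := by
    have : s ⊆ Φ '' Metric.closedBall 0 1 := fun x hx =>
      ⟨Φ.symm x, Metric.ball_subset_closedBall hx, Φ.apply_symm_apply x⟩
    exact (((isCompact_closedBall (0 : ℂ) 1).image Φ.continuous).isBounded).subset this
  have hs2 : MeasurableSet s := Φ.symm.continuous.measurable Metric.isOpen_ball.measurableSet
  have hs3 : volume (frontier s) = 0 := by
    rw [← Φ.symm.preimage_frontier, hΦ.measure_preimage measurableSet_frontier.nullMeasurableSet,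
      frontier_ball _ one_ne_zero, Measure.addHaar_sphere]
  have hvol : volume.real s = π := by
    rw [measureReal_def, hΦ.measure_preimage Metric.isOpen_ball.measurableSet.nullMeasurableSet,
      Complex.volume_ball]
    simp
  have hs4 : ∀ ⦃x y : ℝ⦄, 0 < x → x ≤ y → x • s ⊆ y • s := by
    rintro x y hx hxy _ ⟨z, hz, rfl⟩
    have hy : 0 < y := hx.trans_le hxy
    refine ⟨y⁻¹ • x • z, ?_, by simp [smul_smul, hy.ne']⟩
    rw [hmem] at hz ⊢
    rw [smul_smul, hΦsmul, norm_mul, Complex.norm_real, Real.norm_of_nonneg (by positivity)]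
    refine (mul_le_of_le_one_left (norm_nonneg _) ?_).trans_lt hz
    rw [inv_mul_le_iff₀ hy, mul_one]
    exact hxy
  have h := tendsto_card_div_pow_atTop_volume' s hs1 hs2 hs3 hs4
  rw [hvol] at h
  refine h.congr' ?_
  filter_upwards [eventually_gt_atTop (0 : ℝ)] with ρ hρ
  rw [Fintype.card_fin]
  congr 2
  let j : ℤ × ℤ → Fin 2 → ℝ := fun p => ρ⁻¹ • ![(p.1 : ℝ), (p.2 : ℝ)]
  have hj : Function.Injective j := by
    intro p q hpq
    have h1 := smul_right_injective (Fin 2 → ℝ) (inv_ne_zero hρ.ne') hpq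
    have h2 := congrFun h1 0
    have h3 := congrFun h1 1
    simp only [Matrix.cons_val_zero, Matrix.cons_val_one, Int.cast_inj] at h2 h3
    exact Prod.ext h2 h3
  rw [← Set.ncard_coe_finset, ← Set.ncard_image_of_injective _ hj, ← Nat.card_coe_set_eq]
  congr 2
  have hjn : ∀ p, j p ∈ s ↔ ‖latPt p‖ < ρ := by
    intro p
    have : Φ.symm ![(p.1 : ℝ), (p.2 : ℝ)] = latPt p := by simp [hΦs, latPt]
    rw [hmem, hΦsmul, norm_mul, this, Complex.norm_real, Real.norm_of_nonneg (by positivity),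
      inv_mul_lt_iff₀ hρ, mul_one]
  ext x
  constructor
  · rintro ⟨hx, y, hy, rfl⟩
    rw [SetLike.mem_coe, Module.Basis.mem_span_iff_repr_mem] at hy
    obtain ⟨a, ha⟩ := hy 0
    obtain ⟨b, hb⟩ := hy 1
    have hxy : j (a, b) = ρ⁻¹ • y := by
      simp only [j]
      congr 1
      ext i
      fin_cases i
      · simpa using ha
      · simpa using hb
    refine ⟨(a, b), ?_, hxy⟩
    rw [Finset.mem_coe, mem_latBall, ← hjn, hxy]
    exact hx
  · rintro ⟨p, hp, rfl⟩
    refine ⟨(hjn p).2 (mem_latBall.1 hp), ![(p.1 : ℝ), (p.2 : ℝ)], ?_, rfl⟩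
    rw [SetLike.mem_coe, Module.Basis.mem_span_iff_repr_mem]
    intro i
    fin_cases i
    · exact ⟨p.1, by simp⟩
    · exact ⟨p.2, by simp⟩

theorem tendsto_card_latBall :
    Tendsto (fun ρ : ℝ => (π * ρ ^ 2)⁻¹ * ((latBall ρ).card : ℝ)) atTop (nhds 1) := by
  have h := tendsto_card_latBall_div_sq.const_mul π⁻¹
  rw [inv_mul_cancel₀ pi_ne_zero] at h
  refine h.congr fun ρ => ?_
  rw [mul_inv]; ring

theorem tendsto_card_latBall_shell (c : ℝ) :
    Tendsto (fun ρ : ℝ => (π * ρ ^ 2)⁻¹ *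
      (((latBall ρ).card : ℝ) - ((latBall (ρ - c)).card : ℝ))) atTop (nhds 0) := by
  have h1 : Tendsto (fun ρ : ℝ => ρ - c) atTop atTop := tendsto_atTop_add_const_right _ _ tendsto_id
  have h2 : Tendsto (fun ρ : ℝ => (ρ - c) / ρ) atTop (nhds 1) := by
    have h3 : Tendsto (fun ρ : ℝ => 1 - c * ρ⁻¹) atTop (nhds (1 - c * 0)) :=
      (tendsto_inv_atTop_zero.const_mul c).const_sub 1
    rw [mul_zero, sub_zero] at h3
    refine h3.congr' ?_
    filter_upwards [eventually_ne_atTop (0 : ℝ)] with ρ hρ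
    field_simp
  have h4 := tendsto_card_latBall.sub ((tendsto_card_latBall.comp h1).mul (h2.pow 2))
  rw [one_pow, mul_one, sub_self] at h4
  refine h4.congr' ?_
  filter_upwards [eventually_ne_atTop (0 : ℝ), h1.eventually (eventually_ne_atTop 0)] with ρ hρ hρc
  simp only [Function.comp]
  field_simp

/-- If a bounded function on `ℤ²` gets multiplied by `a ≠ 1` under some translation, then its
averages over large discs tend to zero. -/
theorem tendsto_average_of_translate_eq_mul {χ : ℤ × ℤ → ℂ} (hχ : ∀ p, ‖χ p‖ ≤ 1)
    {e : ℤ × ℤ} {a : ℂ} (ha : a ≠ 1) (he : ∀ p, χ (p + e) = a * χ p) :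
    Tendsto (fun ρ : ℝ => (((π * ρ ^ 2)⁻¹ : ℝ) : ℂ) * ∑ p ∈ latBall ρ, χ p) atTop (nhds 0) := by
  set r := ‖latPt e‖
  have hsub : ∀ {A B : Finset (ℤ × ℤ)}, B ⊆ A →
      ‖∑ p ∈ A, χ p - ∑ p ∈ B, χ p‖ ≤ (A.card : ℝ) - B.card := by
    intro A B hBA
    rw [← Finset.sum_sdiff_eq_sub hBA, ← Nat.cast_sub (Finset.card_le_card hBA),
      ← Finset.card_sdiff_of_subset hBA]
    exact (norm_sum_le_of_le _ fun p _ => hχ p).trans_eq (by simp)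
  have hbound : ∀ ρ : ℝ, ‖∑ p ∈ latBall ρ, χ p‖ ≤
      ‖a - 1‖⁻¹ * (2 * (((latBall ρ).card : ℝ) - (latBall (ρ - r)).card)) := by
    intro ρ
    let A := (latBall ρ).map (addRightEmbedding e)
    have hA : ∑ p ∈ A, χ p = a * ∑ p ∈ latBall ρ, χ p := by
      simp [A, Finset.sum_map, he, Finset.mul_sum]
    have hAc : A.card = (latBall ρ).card := Finset.card_map _
    have hBA : latBall (ρ - r) ⊆ A := by
      intro p hp
      refine Finset.mem_map.2 ⟨p - e, mem_latBall.2 ?_, by simp⟩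
      rw [latPt_sub]
      linarith [norm_sub_le (latPt p) (latPt e), mem_latBall.1 hp]
    have hBB : latBall (ρ - r) ⊆ latBall ρ := latBall_mono (by linarith [norm_nonneg (latPt e)])
    have h1 := hsub hBA
    have h2 := hsub hBB
    rw [hA, hAc] at h1
    have ha' : 0 < ‖a - 1‖ := norm_pos_iff.2 (sub_ne_zero.2 ha)
    rw [le_inv_mul_iff₀ ha', ← norm_mul]
    calc ‖(a - 1) * ∑ p ∈ latBall ρ, χ p‖
        = ‖(a * ∑ p ∈ latBall ρ, χ p - ∑ p ∈ latBall (ρ - r), χ p) -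
            (∑ p ∈ latBall ρ, χ p - ∑ p ∈ latBall (ρ - r), χ p)‖ := by congr 1; ring
      _ ≤ _ := (norm_sub_le _ _).trans (by linarith)
  refine squeeze_zero_norm (fun ρ => ?_)
    (by simpa using (tendsto_card_latBall_shell r).const_mul (‖a - 1‖⁻¹ * 2))
  rw [norm_mul, Complex.norm_real, Real.norm_of_nonneg (by positivity)]
  refine (mul_le_mul_of_nonneg_left (hbound ρ) (by positivity)).trans_eq (by ring)

theorem fourierChar_eq_one_iff {x : ℝ} : (𝐞 x : ℂ) = 1 ↔ ∃ n : ℤ, x = n := by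
  rw [Real.fourierChar_apply, Complex.exp_eq_one_iff]
  refine exists_congr fun n => ?_
  have h : (2 * π * Complex.I : ℂ) ≠ 0 := Complex.two_pi_I_ne_zero
  rw [show ((2 * π * x : ℝ) : ℂ) * Complex.I = (x : ℂ) * (2 * π * Complex.I) by push_cast; ring,
    mul_left_inj' h]
  norm_cast

theorem tendsto_average_fourierChar {k : ℂ} (hk : ∀ m : ℤ × ℤ, k ≠ latPt m) :
    Tendsto (fun ρ : ℝ => (((π * ρ ^ 2)⁻¹ : ℝ) : ℂ) *
      ∑ q ∈ latBall ρ, (𝐞 (inner ℝ (latPt q) k) : ℂ)) atTop (nhds 0) := by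
  have key : ∀ e : ℤ × ℤ, (𝐞 (inner ℝ (latPt e) k) : ℂ) ≠ 1 →
      Tendsto (fun ρ : ℝ => (((π * ρ ^ 2)⁻¹ : ℝ) : ℂ) *
        ∑ q ∈ latBall ρ, (𝐞 (inner ℝ (latPt q) k) : ℂ)) atTop (nhds 0) := by
    intro e he
    refine tendsto_average_of_translate_eq_mul (e := e) (fun p => (Circle.norm_coe _).le) he fun p => ?_
    rw [latPt_add, inner_add_left, AddChar.map_add_eq_mul, Circle.coe_mul, mul_comm]
  by_cases h1 : (𝐞 (inner ℝ (latPt (1, 0)) k) : ℂ) = 1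
  · by_cases h2 : (𝐞 (inner ℝ (latPt (0, 1)) k) : ℂ) = 1
    · obtain ⟨a, ha⟩ := fourierChar_eq_one_iff.1 h1
      obtain ⟨b, hb⟩ := fourierChar_eq_one_iff.1 h2
      refine absurd ?_ (hk (a, b))
      simp only [latPt_eq_mk, Complex.inner] at ha hb
      rw [latPt_eq_mk]
      exact Complex.ext (by simpa using ha) (by simpa using hb)
    · exact key _ h2
  · exact key _ h1

theorem SchwartzMap.tsum_latPt_sub_eq_tsum_fourier (g : SchwartzMap ℂ ℂ) (y : ℂ) :
    ∑' p : ℤ × ℤ, g (latPt p - y) =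
      ∑' p : ℤ × ℤ, (𝐞 (-inner ℝ y (latPt p)) : ℂ) * 𝓕 (g : ℂ → ℂ) (latPt p) := by
  have h := (g.compSubConstCLM ℝ y).tsum_latPt_eq_tsum_fourier
  simp only [SchwartzMap.compSubConstCLM_apply] at h
  rw [h]
  refine tsum_congr fun p => ?_
  have h2 := congrFun (VectorFourier.fourierIntegral_comp_add_right 𝐞 volume
    (innerₗ ℂ) (g : ℂ → ℂ) (-y)) (latPt p)
  rw [Circle.smul_def, innerₗ_apply_apply, inner_neg_left, smul_eq_mul] at h2
  exact h2

theorem tendsto_average_tsum_schwartz {u : ℂ} (hu : ‖u‖ = 1)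
    (hgen : ∀ p q : ℤ × ℤ, latPt p = u * latPt q → p = 0) (g : SchwartzMap ℂ ℂ) :
    Tendsto (fun ρ : ℝ => (((π * ρ ^ 2)⁻¹ : ℝ) : ℂ) *
      ∑ q ∈ latBall ρ, ∑' p : ℤ × ℤ, g (latPt p - u * latPt q)) atTop (nhds (∫ z, g z)) := by
  let χ : ℤ × ℤ → ℤ × ℤ → ℂ := fun p q => 𝐞 (-inner ℝ (u * latPt q) (latPt p))
  have hχ : ∀ p q, ‖χ p q‖ = 1 := fun p q => Circle.norm_coe _
  have hF := g.summable_fourier_latPt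
  have hFn := hF.norm
  have hswap : ∀ ρ : ℝ, (((π * ρ ^ 2)⁻¹ : ℝ) : ℂ) *
      ∑ q ∈ latBall ρ, ∑' p : ℤ × ℤ, g (latPt p - u * latPt q) =
      ∑' p : ℤ × ℤ, ((((π * ρ ^ 2)⁻¹ : ℝ) : ℂ) * ∑ q ∈ latBall ρ, χ p q) *
        𝓕 (g : ℂ → ℂ) (latPt p) := by
    intro ρ
    simp_rw [g.tsum_latPt_sub_eq_tsum_fourier]
    rw [← Summable.tsum_finsetSum, ← tsum_mul_left]
    · refine tsum_congr fun p => ?_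
      rw [mul_assoc, Finset.sum_mul]
    · intro q _
      refine Summable.of_norm_bounded hFn fun p => ?_
      rw [norm_mul]
      exact (congrArg (· * _) (hχ p q)).trans_le (one_mul _).le
  simp_rw [hswap]
  have hint : ∫ z, g z = ∑' p : ℤ × ℤ, (if p = 0 then 1 else 0) * 𝓕 (g : ℂ → ℂ) (latPt p) := by
    simp_rw [ite_mul, one_mul, zero_mul]
    rw [tsum_ite_eq, latPt_zero, Real.fourier_eq]
    simp
  rw [hint]
  refine tendsto_tsum_of_dominated_convergence (hFn.mul_left 2) (fun p => ?_) ?_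
  · refine Tendsto.mul_const _ ?_
    split_ifs with hp
    · subst hp
      have h := Complex.continuous_ofReal.continuousAt.tendsto.comp tendsto_card_latBall
      refine h.congr fun ρ => ?_
      simp [χ, latPt_zero]
    · have hu0 : u ≠ 0 := norm_ne_zero_iff.1 (by rw [hu]; exact one_ne_zero)
      have huu : u * (starRingEnd ℂ) u = 1 := by
        rw [Complex.mul_conj, Complex.normSq_eq_norm_sq, hu]; norm_num
      have h := tendsto_average_fourierChar (k := -((starRingEnd ℂ) u * latPt p)) (fun m hm => by
        refine hp (hgen p (-m) ?_)
        have hneg : latPt (-m) = -latPt m := by simpa [latPt_zero] using latPt_sub 0 m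
        rw [hneg, ← hm, neg_neg, ← mul_assoc, huu, one_mul])
      refine h.congr fun ρ => ?_
      congr 1
      refine Finset.sum_congr rfl fun q _ => ?_
      simp only [χ]
      congr 3
      rw [inner_neg_right]
      simp only [Complex.inner, map_mul]
      congr 2
      ring
  · filter_upwards [tendsto_card_latBall.eventually (eventually_le_nhds (one_lt_two))] with ρ hρ p
    rw [norm_mul, norm_mul, Complex.norm_real, Real.norm_of_nonneg (by positivity)]
    gcongr
    refine le_trans ?_ hρ
    gcongr
    exact (norm_sum_le _ _).trans_eq (by simp [hχ])

theorem exists_norm_sub_latPt_le_one (z : ℂ) : ∃ m : ℤ × ℤ, ‖z - latPt m‖ ≤ 1 := by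
  refine ⟨(round z.re, round z.im), (Complex.norm_le_abs_re_add_abs_im _).trans ?_⟩
  rw [Complex.sub_re, Complex.sub_im, latPt_re, latPt_im]
  linarith [abs_sub_round z.re, abs_sub_round z.im]

/-- The number of points of a rotated lattice in a disc is bounded uniformly in the centre. -/
theorem exists_finset_norm_lt {v : ℂ} (hv : ‖v‖ = 1) (c : ℝ) (y : ℂ) :
    ∃ T : Finset (ℤ × ℤ), T.card = (latBall (c + 1)).card ∧
      ∀ p, ‖v * latPt p - y‖ < c → p ∈ T := by
  have hv0 : v ≠ 0 := norm_ne_zero_iff.1 (by rw [hv]; exact one_ne_zero)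
  obtain ⟨m, hm⟩ := exists_norm_sub_latPt_le_one (v⁻¹ * y)
  refine ⟨(latBall (c + 1)).map (addRightEmbedding m), Finset.card_map _, fun p hp => ?_⟩
  refine Finset.mem_map.2 ⟨p - m, mem_latBall.2 ?_, by simp⟩
  have h1 : ‖latPt p - v⁻¹ * y‖ < c := by
    have : v * latPt p - y = v * (latPt p - v⁻¹ * y) := by field_simp
    rwa [this, norm_mul, hv, one_mul] at hp
  have h2 : latPt (p - m) = (latPt p - v⁻¹ * y) + (v⁻¹ * y - latPt m) := by rw [latPt_sub]; ring
  rw [h2]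
  linarith [norm_add_le (latPt p - v⁻¹ * y) (v⁻¹ * y - latPt m)]

section BoundedSupport

variable {h : ℂ → ℝ} {c A : ℝ} {v : ℂ}

theorem summable_latPt_sub (hc : ∀ z, c ≤ ‖z‖ → h z = 0) (hv : ‖v‖ = 1) (y : ℂ) :
    Summable fun p : ℤ × ℤ => h (v * latPt p - y) := by
  obtain ⟨T, -, hT⟩ := exists_finset_norm_lt hv c y
  exact summable_of_ne_finset_zero (s := T) fun p hp => hc _ (not_lt.1 (mt (hT p) hp))

theorem abs_tsum_latPt_sub_sum_le (hc : ∀ z, c ≤ ‖z‖ → h z = 0) (hA : ∀ z, |h z| ≤ A)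
    (hv : ‖v‖ = 1) (y : ℂ) (B : Finset (ℤ × ℤ)) :
    |∑' p : ℤ × ℤ, h (v * latPt p - y) - ∑ p ∈ B, h (v * latPt p - y)| ≤
      (latBall (c + 1)).card * A := by
  obtain ⟨T, hTc, hT⟩ := exists_finset_norm_lt hv c y
  have h0 : ∀ p ∉ T, h (v * latPt p - y) = 0 := fun p hp => hc _ (not_lt.1 (mt (hT p) hp))
  have hA0 : 0 ≤ A := (abs_nonneg _).trans (hA 0)
  rw [tsum_eq_sum (s := B ∪ T) fun p hp => h0 p fun h => hp (Finset.mem_union_right _ h),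
    ← Finset.sum_sdiff_eq_sub Finset.subset_union_left, Finset.union_sdiff_left]
  refine (Finset.abs_sum_le_sum_abs _ _).trans
    ((Finset.sum_le_card_nsmul _ _ A fun p _ => hA _).trans ?_)
  rw [nsmul_eq_mul, ← hTc]
  gcongr
  exact Finset.sdiff_subset

theorem abs_tsum_latPt_sub_le (hc : ∀ z, c ≤ ‖z‖ → h z = 0) (hA : ∀ z, |h z| ≤ A)
    (hv : ‖v‖ = 1) (y : ℂ) :
    |∑' p : ℤ × ℤ, h (v * latPt p - y)| ≤ (latBall (c + 1)).card * A := by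
  simpa using abs_tsum_latPt_sub_sum_le hc hA hv y ∅

/-- Replacing the sum over `p ∈ ℤ²` by a sum over a large disc does not change the averages. -/
theorem tendsto_average_sum_of_tendsto_average_tsum (hc : ∀ z, c ≤ ‖z‖ → h z = 0)
    (hA : ∀ z, |h z| ≤ A) {w : ℂ} (hv : ‖v‖ = 1) (hw : ‖w‖ = 1) {l : ℝ}
    (hl : Tendsto (fun ρ : ℝ => (π * ρ ^ 2)⁻¹ *
      ∑ q ∈ latBall ρ, ∑' p : ℤ × ℤ, h (v * latPt p - w * latPt q)) atTop (nhds l)) :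
    Tendsto (fun ρ : ℝ => (π * ρ ^ 2)⁻¹ *
      ∑ q ∈ latBall ρ, ∑ p ∈ latBall ρ, h (v * latPt p - w * latPt q)) atTop (nhds l) := by
  by_cases hc0 : c < 0
  · have : ∀ z, h z = 0 := fun z => hc z (hc0.le.trans (norm_nonneg z))
    simpa [this] using hl
  have hc0 := not_lt.1 hc0
  have hdiff : Tendsto (fun ρ : ℝ => (π * ρ ^ 2)⁻¹ *
      ∑ q ∈ latBall ρ, (∑' p : ℤ × ℤ, h (v * latPt p - w * latPt q) -
        ∑ p ∈ latBall ρ, h (v * latPt p - w * latPt q))) atTop (nhds 0) := by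
    have hb := (tendsto_card_latBall_shell c).const_mul ((latBall (c + 1)).card * A)
    rw [mul_zero] at hb
    refine squeeze_zero_norm (fun ρ => ?_) hb
    have hsub : latBall (ρ - c) ⊆ latBall ρ := latBall_mono (by linarith)
    have hzero : ∀ q ∈ latBall (ρ - c), ∑' p : ℤ × ℤ, h (v * latPt p - w * latPt q) -
        ∑ p ∈ latBall ρ, h (v * latPt p - w * latPt q) = 0 := by
      intro q hq
      rw [sub_eq_zero]
      refine tsum_eq_sum fun p hp => hc _ ?_
      have h1 := mem_latBall.1 hq
      have h2 := not_lt.1 (mt mem_latBall.2 hp)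
      have h3 := norm_sub_norm_le (v * latPt p) (w * latPt q)
      rw [norm_mul, norm_mul, hv, hw, one_mul, one_mul] at h3
      linarith
    rw [norm_mul, Real.norm_of_nonneg (by positivity : (0 : ℝ) ≤ (π * ρ ^ 2)⁻¹),
      mul_left_comm]
    gcongr
    rw [← Finset.sum_sdiff hsub, Finset.sum_eq_zero hzero, add_zero, ← Nat.cast_sub
      (Finset.card_le_card hsub), ← Finset.card_sdiff_of_subset hsub]
    refine (norm_sum_le_of_le _ fun q _ =>
      abs_tsum_latPt_sub_sum_le hc hA hv (w * latPt q) (latBall ρ)).trans_eq ?_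
    rw [Finset.sum_const, nsmul_eq_mul, mul_comm]
  have := hl.sub hdiff
  rw [sub_zero] at this
  refine this.congr fun ρ => ?_
  rw [Finset.sum_sub_distrib]
  ring

theorem tendsto_average_same_lattice (hc : ∀ z, c ≤ ‖z‖ → h z = 0)
    (hA : ∀ z, |h z| ≤ A) (hv : ‖v‖ = 1) :
    Tendsto (fun ρ : ℝ => (π * ρ ^ 2)⁻¹ *
      ∑ q ∈ latBall ρ, ∑ p ∈ latBall ρ, h (v * latPt p - v * latPt q)) atTop
      (nhds (∑' p : ℤ × ℤ, h (v * latPt p))) := by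
  refine tendsto_average_sum_of_tendsto_average_tsum hc hA hv hv ?_
  have hq : ∀ q : ℤ × ℤ, ∑' p : ℤ × ℤ, h (v * latPt p - v * latPt q) =
      ∑' p : ℤ × ℤ, h (v * latPt p) := by
    intro q
    rw [← (Equiv.subRight q).tsum_eq (fun p => h (v * latPt p))]
    refine tsum_congr fun p => ?_
    rw [Equiv.subRight_apply, latPt_sub, mul_sub]
  have := tendsto_card_latBall.mul_const (∑' p : ℤ × ℤ, h (v * latPt p))
  rw [one_mul] at this
  refine this.congr fun ρ => ?_
  simp_rw [hq]
  rw [Finset.sum_const, nsmul_eq_mul, mul_assoc]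

end BoundedSupport

theorem exists_bounds_of_hasCompactSupport {f : ℂ → ℝ} (hf : Continuous f)
    (hfs : HasCompactSupport f) :
    ∃ c A : ℝ, (∀ z, c ≤ ‖z‖ → f z = 0) ∧ ∀ z, |f z| ≤ A := by
  obtain ⟨A, hA⟩ := hf.bounded_above_of_compact_support hfs
  obtain ⟨c, hc⟩ := hfs.isBounded.subset_ball 0
  refine ⟨c, A, fun z hz => ?_, hA⟩
  by_contra h
  have := hc (subset_tsupport f (Function.mem_support.2 h))
  rw [mem_ball_zero_iff] at this
  linarith

theorem tendsto_average_tsum_generic {u : ℂ} (hu : ‖u‖ = 1)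
    (hgen : ∀ p q : ℤ × ℤ, latPt p = u * latPt q → p = 0) {f : ℂ → ℝ} (hf : Continuous f)
    (hfs : HasCompactSupport f) :
    Tendsto (fun ρ : ℝ => (π * ρ ^ 2)⁻¹ *
      ∑ q ∈ latBall ρ, ∑' p : ℤ × ℤ, f (1 * latPt p - u * latPt q)) atTop
      (nhds (∫ z, f z)) := by
  obtain ⟨c, -, hc, -⟩ := exists_bounds_of_hasCompactSupport hf hfs
  rw [Metric.tendsto_nhds]
  intro ε hε
  set M : ℝ := ((latBall (c + 1)).card : ℝ) with hM
  set V : ℝ := volume.real (Metric.ball (0 : ℂ) c)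
  have hV : 0 ≤ V := measureReal_nonneg
  obtain ⟨δ, hδ, hδε⟩ : ∃ δ : ℝ, 0 < δ ∧ 2 * (M * δ) + V * δ < ε / 2 := by
    refine ⟨ε / 2 / (2 * M + V + 1), by positivity, ?_⟩
    rw [show 2 * (M * (ε / 2 / (2 * M + V + 1))) + V * (ε / 2 / (2 * M + V + 1)) =
      (2 * M + V) * (ε / 2) / (2 * M + V + 1) by ring, div_lt_iff₀ (by positivity)]
    nlinarith
  obtain ⟨g, hg, hgf, hgs⟩ := hf.exists_contDiff_approx ⊤ (ε := fun _ => δ) continuous_const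
    fun _ => hδ
  have hgcs : HasCompactSupport g := hfs.mono hgs
  have hgc : ∀ z, c ≤ ‖z‖ → g z = 0 := fun z hz => by
    by_contra h
    exact hgs (Function.mem_support.2 h) (hc z hz)
  have hfgc : ∀ z, c ≤ ‖z‖ → f z - g z = 0 := fun z hz => by rw [hc z hz, hgc z hz, sub_zero]
  have hfgA : ∀ z, |f z - g z| ≤ δ := fun z => by
    rw [abs_sub_comm]; exact (hgf z).le
  let G : SchwartzMap ℂ ℂ := (hgcs.comp_left (g := Complex.ofReal) Complex.ofReal_zero).toSchwartzMap
    (Complex.ofRealCLM.contDiff.comp hg)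
  have hG : ∀ z, G z = (g z : ℂ) := fun z => rfl
  have hlim : Tendsto (fun ρ : ℝ => (π * ρ ^ 2)⁻¹ *
      ∑ q ∈ latBall ρ, ∑' p : ℤ × ℤ, g (1 * latPt p - u * latPt q)) atTop (nhds (∫ z, g z)) := by
    have h := tendsto_average_tsum_schwartz hu hgen G
    simp only [hG, integral_complex_ofReal, ← Complex.ofReal_tsum, ← Complex.ofReal_sum,
      ← Complex.ofReal_mul] at h
    simp only [one_mul]
    exact (Complex.continuous_re.tendsto _).comp h
  have hint : |(∫ z, f z) - ∫ z, g z| ≤ V * δ := by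
    rw [← integral_sub (hf.integrable_of_hasCompactSupport hfs)
      (hg.continuous.integrable_of_hasCompactSupport hgcs),
      ← setIntegral_eq_integral_of_forall_compl_eq_zero (s := Metric.ball (0 : ℂ) c)
        fun z hz => hfgc z (by simpa using hz), mul_comm]
    exact norm_setIntegral_le_of_norm_le_const measure_ball_lt_top fun z _ => (Real.norm_eq_abs _).trans_le (hfgA z)
  filter_upwards [Metric.tendsto_nhds.1 hlim (ε / 2) (half_pos hε),
    tendsto_card_latBall.eventually (eventually_le_nhds one_lt_two)] with ρ h1 h2
  have h3 : |(π * ρ ^ 2)⁻¹ * ∑ q ∈ latBall ρ, ∑' p : ℤ × ℤ, f (1 * latPt p - u * latPt q) -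
      (π * ρ ^ 2)⁻¹ * ∑ q ∈ latBall ρ, ∑' p : ℤ × ℤ, g (1 * latPt p - u * latPt q)| ≤
      2 * (M * δ) := by
    rw [← mul_sub, ← Finset.sum_sub_distrib, abs_mul,
      abs_of_nonneg (by positivity : (0 : ℝ) ≤ (π * ρ ^ 2)⁻¹)]
    have : |∑ q ∈ latBall ρ, (∑' p : ℤ × ℤ, f (1 * latPt p - u * latPt q) -
        ∑' p : ℤ × ℤ, g (1 * latPt p - u * latPt q))| ≤ (latBall ρ).card * (M * δ) := by
      refine (Finset.abs_sum_le_sum_abs _ _).trans ((Finset.sum_le_card_nsmul _ _ (M * δ)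
        fun q _ => ?_).trans_eq (nsmul_eq_mul _ _))
      rw [← (summable_latPt_sub hc norm_one _).tsum_sub (summable_latPt_sub hgc norm_one _)]
      exact abs_tsum_latPt_sub_le (h := fun z => f z - g z) hfgc hfgA norm_one _
    calc _ ≤ (π * ρ ^ 2)⁻¹ * ((latBall ρ).card * (M * δ)) := by gcongr
      _ = ((π * ρ ^ 2)⁻¹ * (latBall ρ).card) * (M * δ) := by ring
      _ ≤ _ := by gcongr
  rw [Real.dist_eq] at h1 ⊢
  rw [abs_le] at h3 hint
  rw [abs_lt] at h1 ⊢
  constructor <;> linarith [h1.1, h1.2, h3.1, h3.2, hint.1, hint.2]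

theorem restrict_rotLatticeComb_ball {v : ℂ} (hv : ‖v‖ = 1) (ρ : ℝ) :
    (rotLatticeComb v).restrict (Metric.ball (0 : ℂ) ρ) =
      ∑ p ∈ latBall ρ, Measure.dirac (v * latPt p) := by
  ext s hs
  have hmem : ∀ p, v * latPt p ∈ Metric.ball (0 : ℂ) ρ ↔ p ∈ latBall ρ := fun p => by
    rw [mem_ball_zero_iff, norm_mul, hv, one_mul, mem_latBall]
  have hms := hs.inter (measurableSet_ball (x := (0 : ℂ)) (ε := ρ))
  rw [Measure.restrict_apply hs, rotLatticeComb, Measure.sum_apply _ hms,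
    Measure.finsetSum_apply, tsum_eq_sum (s := latBall ρ)]
  · refine Finset.sum_congr rfl fun p hp => ?_
    rw [Measure.dirac_apply' _ hms, Measure.dirac_apply' _ hs]
    by_cases h : v * latPt p ∈ s
    · rw [Set.indicator_of_mem (Set.mem_inter h ((hmem p).2 hp)), Set.indicator_of_mem h]
    · rw [Set.indicator_of_notMem (fun h2 => h h2.1), Set.indicator_of_notMem h]
  · intro p hp
    rw [Measure.dirac_apply' _ hms]
    exact Set.indicator_of_notMem (fun h => mt (hmem p).1 hp h.2) _

/-- The restriction of the averaged comb to the disc of radius `ρ`. -/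
theorem integral_restrict_two_combs {u : ℂ} (hu : ‖u‖ = 1) (ρ : ℝ) (g : ℂ → ℝ) :
    ∫ z, g z ∂(((2 : ℝ≥0∞)⁻¹ • (rotLatticeComb 1 + rotLatticeComb u)).restrict
      (Metric.ball (0 : ℂ) ρ)) =
      2⁻¹ * (∑ p ∈ latBall ρ, g (1 * latPt p) + ∑ p ∈ latBall ρ, g (u * latPt p)) := by
  have hi : ∀ v : ℂ, Integrable g (∑ p ∈ latBall ρ, Measure.dirac (v * latPt p)) := fun v =>
    integrable_finsetSum_measure.2 fun p _ => integrable_dirac (by simp)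
  rw [Measure.restrict_smul, Measure.restrict_add, restrict_rotLatticeComb_ball norm_one,
    restrict_rotLatticeComb_ball hu, integral_smul_measure, integral_add_measure (hi 1) (hi u),
    integral_finsetSum_measure fun p _ => integrable_dirac (by simp),
    integral_finsetSum_measure fun p _ => integrable_dirac (by simp)]
  simp only [integral_dirac, smul_eq_mul, ENNReal.toReal_inv, ENNReal.toReal_ofNat]

theorem isFiniteMeasure_restrict_two_combs {u : ℂ} (hu : ‖u‖ = 1) (ρ : ℝ) :
    IsFiniteMeasure (((2 : ℝ≥0∞)⁻¹ • (rotLatticeComb 1 + rotLatticeComb u)).restrict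
      (Metric.ball (0 : ℂ) ρ)) := by
  rw [Measure.restrict_smul, Measure.restrict_add, restrict_rotLatticeComb_ball norm_one,
    restrict_rotLatticeComb_ball hu]
  exact Measure.smul_finite _ (by simp)

theorem integral_correlation_two_combs {u : ℂ} (hu : ‖u‖ = 1) (ρ : ℝ) {f : ℂ → ℝ}
    (hf : Continuous f) (hfs : HasCompactSupport f) :
    ∫ z, f z ∂((ENNReal.ofReal (π * ρ ^ 2))⁻¹ •
      Measure.map (fun q : ℂ × ℂ => q.1 - q.2)
        ((((2 : ℝ≥0∞)⁻¹ • (rotLatticeComb 1 + rotLatticeComb u)).restrict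
            (Metric.ball (0 : ℂ) ρ)).prod
          (((2 : ℝ≥0∞)⁻¹ • (rotLatticeComb 1 + rotLatticeComb u)).restrict
            (Metric.ball (0 : ℂ) ρ)))) =
      4⁻¹ * ((π * ρ ^ 2)⁻¹ *
          (∑ q ∈ latBall ρ, ∑ p ∈ latBall ρ, f (1 * latPt p - 1 * latPt q)) +
        (π * ρ ^ 2)⁻¹ *
          (∑ q ∈ latBall ρ, ∑ p ∈ latBall ρ, f (1 * latPt p - u * latPt q)) +
        (π * ρ ^ 2)⁻¹ *
          (∑ q ∈ latBall ρ, ∑ p ∈ latBall ρ, f (u * latPt p - 1 * latPt q)) +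
        (π * ρ ^ 2)⁻¹ *
          (∑ q ∈ latBall ρ, ∑ p ∈ latBall ρ, f (u * latPt p - u * latPt q))) := by
  have := isFiniteMeasure_restrict_two_combs hu ρ
  obtain ⟨A, hA⟩ := hf.bounded_above_of_compact_support hfs
  rw [integral_smul_measure, integral_map (by fun_prop) hf.aestronglyMeasurable,
    integral_prod_symm (fun q : ℂ × ℂ => f (q.1 - q.2)) (Integrable.of_bound
      (hf.comp (continuous_fst.sub continuous_snd)).aestronglyMeasurable A
      (Eventually.of_forall fun z => hA _))]
  simp only [integral_restrict_two_combs hu]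
  rw [ENNReal.toReal_inv, ENNReal.toReal_ofReal (by positivity), smul_eq_mul]
  simp only [← Finset.mul_sum, Finset.sum_add_distrib]
  ring

theorem tendsto_correlation_two_combs {u : ℂ} (hu : ‖u‖ = 1)
    (hgen : ∀ p q : ℤ × ℤ, latPt p = u * latPt q → p = 0) {f : ℂ → ℝ}
    (hf : Continuous f) (hfs : HasCompactSupport f) :
    Tendsto (fun ρ : ℝ =>
      ∫ z, f z ∂((ENNReal.ofReal (π * ρ ^ 2))⁻¹ •
        Measure.map (fun q : ℂ × ℂ => q.1 - q.2)
          ((((2 : ℝ≥0∞)⁻¹ • (rotLatticeComb 1 + rotLatticeComb u)).restrict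
              (Metric.ball (0 : ℂ) ρ)).prod
            (((2 : ℝ≥0∞)⁻¹ • (rotLatticeComb 1 + rotLatticeComb u)).restrict
              (Metric.ball (0 : ℂ) ρ))))) atTop
      (nhds (4⁻¹ * ∑' p, f (1 * latPt p) + 4⁻¹ * ∑' p, f (u * latPt p) + 2⁻¹ * ∫ z, f z)) := by
  have hcross : ∀ {f : ℂ → ℝ}, Continuous f → HasCompactSupport f →
      Tendsto (fun ρ : ℝ => (π * ρ ^ 2)⁻¹ *
        ∑ q ∈ latBall ρ, ∑ p ∈ latBall ρ, f (1 * latPt p - u * latPt q)) atTop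
        (nhds (∫ z, f z)) := fun hf hfs => by
    obtain ⟨c, A, hc, hA⟩ := exists_bounds_of_hasCompactSupport hf hfs
    exact tendsto_average_sum_of_tendsto_average_tsum hc hA norm_one hu
      (tendsto_average_tsum_generic hu hgen hf hfs)
  obtain ⟨c, A, hc, hA⟩ := exists_bounds_of_hasCompactSupport hf hfs
  have hswap : Tendsto (fun ρ : ℝ => (π * ρ ^ 2)⁻¹ *
      ∑ q ∈ latBall ρ, ∑ p ∈ latBall ρ, f (u * latPt p - 1 * latPt q)) atTop
      (nhds (∫ z, f z)) := by
    have h := hcross (hf.comp continuous_neg) (hfs.comp_homeomorph (Homeomorph.neg ℂ))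
    simp only [Function.comp_apply, integral_neg_eq_self f, neg_sub] at h
    refine h.congr fun ρ => ?_
    rw [Finset.sum_comm]
  have h := ((((tendsto_average_same_lattice hc hA norm_one).add (hcross hf hfs)).add hswap).add
    (tendsto_average_same_lattice hc hA hu)).const_mul 4⁻¹
  convert h.congr fun ρ => (integral_correlation_two_combs hu ρ hf hfs).symm using 2
  ring

section Integrals

variable {E : Type*} [NormedAddCommGroup E]

theorem integrable_rotLatticeComb {v : ℂ} {f : ℂ → E}
    (hs : Summable fun p : ℤ × ℤ => ‖f (v * latPt p)‖) : Integrable f (rotLatticeComb v) :=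
  integrable_sum_measure (fun p => integrable_dirac (by simp)) (by simpa using hs)

variable [NormedSpace ℝ E] [CompleteSpace E]

theorem integral_rotLatticeComb {v : ℂ} {f : ℂ → E}
    (hs : Summable fun p : ℤ × ℤ => ‖f (v * latPt p)‖) :
    ∫ z, f z ∂rotLatticeComb v = ∑' p : ℤ × ℤ, f (v * latPt p) := by
  rw [rotLatticeComb, integral_sum_measure (integrable_rotLatticeComb hs)]
  simp

theorem integral_autocorrelation {u : ℂ} {f : ℂ → E} (hf : Integrable f)
    (hs1 : Summable fun p : ℤ × ℤ => ‖f (1 * latPt p)‖)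
    (hsu : Summable fun p : ℤ × ℤ => ‖f (u * latPt p)‖) :
    ∫ z, f z ∂((4 : ℝ≥0∞)⁻¹ • rotLatticeComb 1 +
      (4 : ℝ≥0∞)⁻¹ • rotLatticeComb u + (2 : ℝ≥0∞)⁻¹ • volume) =
      (4⁻¹ : ℝ) • ∑' p, f (1 * latPt p) + (4⁻¹ : ℝ) • ∑' p, f (u * latPt p) +
        (2⁻¹ : ℝ) • ∫ z, f z := by
  have h1 := (integrable_rotLatticeComb hs1).smul_measure (c := (4 : ℝ≥0∞)⁻¹) (by simp)
  have h2 := (integrable_rotLatticeComb hsu).smul_measure (c := (4 : ℝ≥0∞)⁻¹) (by simp)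
  have h3 := hf.smul_measure (c := (2 : ℝ≥0∞)⁻¹) (by simp)
  rw [integral_add_measure (h1.add_measure h2) h3, integral_add_measure h1 h2,
    integral_smul_measure, integral_smul_measure, integral_smul_measure,
    integral_rotLatticeComb hs1, integral_rotLatticeComb hsu]
  simp only [ENNReal.toReal_inv, ENNReal.toReal_ofNat]

theorem integral_diffraction {u : ℂ} {f : ℂ → E}
    (hs1 : Summable fun p : ℤ × ℤ => ‖f (latPt p)‖)
    (hsu : Summable fun p : ℤ × ℤ => ‖f (u * latPt p)‖) :
    ∫ z, f z ∂(Measure.dirac (0 : ℂ) +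
      (4 : ℝ≥0∞)⁻¹ • Measure.sum (fun p : {p : ℤ × ℤ // p ≠ 0} =>
        Measure.dirac (latPt p) + Measure.dirac (u * latPt p))) =
      (4⁻¹ : ℝ) • ∑' p, f (latPt p) + (4⁻¹ : ℝ) • ∑' p, f (u * latPt p) + (2⁻¹ : ℝ) • f 0 := by
  have hd : ∀ z, Integrable f (Measure.dirac z) := fun z => integrable_dirac (by simp)
  have hcoe : Function.Injective (Subtype.val : {p : ℤ × ℤ // p ≠ 0} → ℤ × ℤ) :=
    Subtype.val_injective
  have hs1' := hs1.comp_injective hcoe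
  have hsu' := hsu.comp_injective hcoe
  have hi : Integrable f (Measure.sum (fun p : {p : ℤ × ℤ // p ≠ 0} =>
      Measure.dirac (latPt p) + Measure.dirac (u * latPt p))) := by
    refine integrable_sum_measure (fun p => (hd _).add_measure (hd _)) ?_
    refine (hs1'.add hsu').congr fun p => ?_
    rw [integral_add_measure (hd _).norm (hd _).norm, integral_dirac, integral_dirac]
    rfl
  rw [integral_add_measure (hd 0) (hi.smul_measure (by simp)), integral_smul_measure,
    integral_sum_measure hi, integral_dirac]
  simp only [integral_add_measure (hd _) (hd _), integral_dirac]
  rw [Summable.tsum_add hs1'.of_norm hsu'.of_norm]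
  have key : ∀ {v : ℂ}, Summable (fun p : ℤ × ℤ => ‖f (v * latPt p)‖) →
      ∑' p, f (v * latPt p) = f 0 + ∑' p : {p : ℤ × ℤ // p ≠ 0}, f (v * latPt p) := by
    intro v hv
    have h := hv.of_norm.sum_add_tsum_subtype_compl {0}
    rw [Finset.sum_singleton, latPt_zero, mul_zero] at h
    rw [← h]
    congr 1
    exact (Equiv.subtypeEquivRight fun p => by simp).tsum_eq
      fun p : {p : ℤ × ℤ // p ≠ 0} => f (v * latPt p)
  have k1 := key (v := 1) (by simpa only [one_mul] using hs1)
  simp only [one_mul] at k1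
  rw [k1, key hsu, ENNReal.toReal_inv, ENNReal.toReal_ofNat]
  module

end Integrals

theorem SchwartzMap.integral_fourier_eq_apply_zero (f : SchwartzMap ℂ ℂ) :
    ∫ z, 𝓕 (f : ℂ → ℂ) z = f 0 := by
  have h := congrFun (f.continuous.fourierInv_fourier_eq f.integrable (𝓕 f).integrable) 0
  rw [Real.fourierInv_eq] at h
  simpa using h

/-- Precomposition of a Schwartz function with multiplication by a unit complex number. -/
theorem SchwartzMap.exists_comp_unit_mul (f : SchwartzMap ℂ ℂ) {u : ℂ} (hu : ‖u‖ = 1) :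
    ∃ g : SchwartzMap ℂ ℂ, (∀ z, g z = f (u * z)) ∧
      ∀ z, 𝓕 (g : ℂ → ℂ) z = 𝓕 (f : ℂ → ℂ) (u * z) := by
  let R : ℂ ≃ₗᵢ[ℝ] ℂ := rotation ⟨u, mem_sphere_zero_iff_norm.2 hu⟩
  have hR : ∀ z, R z = u * z := fun z => rfl
  refine ⟨SchwartzMap.compCLMOfContinuousLinearEquiv ℝ R.toContinuousLinearEquiv f,
    fun z => rfl, fun z => ?_⟩
  rw [← hR]
  exact Real.fourier_comp_linearIsometry R f z

/-- Let `R ∈ SO(2)` (multiplication by a unit complex number `u`) be a generic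
rotation, i.e. `ℤ² ∩ Rℤ² = {0}`. Then the autocorrelation of
`ω = ½(δ_{ℤ²} + δ_{Rℤ²})` — the vague limit of the volume-averaged correlation
measures over balls of radius `ρ → ∞` — is `γ = ¼δ_{ℤ²} + ¼δ_{Rℤ²} + ½λ`, with
`λ` Lebesgue measure; and the diffraction measure (Fourier transform of `γ` as a
tempered distribution) is `γ̂ = ∑_{x ∈ ℤ² ∪ Rℤ²} I(x) δ_x` with `I(0) = 1` and
`I(x) = ¼` for `x ≠ 0`. -/
theorem two_rotated_lattices_autocorrelation_and_diffraction
    (u : ℂ) (hu : ‖u‖ = 1)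
    (hgen : {z : ℂ | ∃ p : ℤ × ℤ, z = latPt p} ∩
            {z : ℂ | ∃ p : ℤ × ℤ, z = u * latPt p} = {0}) :
    (∀ f : ℂ → ℝ, Continuous f → HasCompactSupport f →
      Tendsto (fun ρ : ℝ =>
          ∫ z, f z ∂((ENNReal.ofReal (π * ρ ^ 2))⁻¹ •
            Measure.map (fun q : ℂ × ℂ => q.1 - q.2)
              ((((2 : ℝ≥0∞)⁻¹ • (rotLatticeComb 1 + rotLatticeComb u)).restrict
                  (Metric.ball (0 : ℂ) ρ)).prod
                (((2 : ℝ≥0∞)⁻¹ • (rotLatticeComb 1 + rotLatticeComb u)).restrict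
                  (Metric.ball (0 : ℂ) ρ)))))
        atTop
        (nhds (∫ z, f z ∂((4 : ℝ≥0∞)⁻¹ • rotLatticeComb 1 +
          (4 : ℝ≥0∞)⁻¹ • rotLatticeComb u + (2 : ℝ≥0∞)⁻¹ • volume)))) ∧
    (∀ f : SchwartzMap ℂ ℂ,
      ∫ z, 𝓕 (⇑f) z ∂((4 : ℝ≥0∞)⁻¹ • rotLatticeComb 1 +
          (4 : ℝ≥0∞)⁻¹ • rotLatticeComb u + (2 : ℝ≥0∞)⁻¹ • volume) =
      ∫ z, f z ∂(Measure.dirac (0 : ℂ) +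
        (4 : ℝ≥0∞)⁻¹ • Measure.sum (fun p : {p : ℤ × ℤ // p ≠ 0} =>
          Measure.dirac (latPt p) + Measure.dirac (u * latPt p)))) := by
  have hgen' : ∀ p q : ℤ × ℤ, latPt p = u * latPt q → p = 0 := fun p q h =>
    latPt_injective ((hgen.subset ⟨⟨p, rfl⟩, ⟨q, h⟩⟩ : latPt p = 0).trans latPt_zero.symm)
  refine ⟨fun f hf hfs => ?_, fun f => ?_⟩
  · obtain ⟨c, A, hc, -⟩ := exists_bounds_of_hasCompactSupport hf hfs
    have hs : ∀ v : ℂ, ‖v‖ = 1 → Summable fun p : ℤ × ℤ => ‖f (v * latPt p)‖ := fun v hv => by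
      simpa only [sub_zero] using (summable_latPt_sub hc hv 0).norm
    rw [integral_autocorrelation (hf.integrable_of_hasCompactSupport hfs) (hs 1 norm_one)
      (hs u hu)]
    exact tendsto_correlation_two_combs hu hgen' hf hfs
  · obtain ⟨g, hg, hgF⟩ := f.exists_comp_unit_mul hu
    have h1 := f.summable_fourier_latPt.norm
    have h2 := g.summable_fourier_latPt.norm
    have h3 := g.summable_latPt.norm
    have h4 := g.tsum_latPt_eq_tsum_fourier
    simp only [hg] at h3 h4
    simp only [hgF] at h2 h4
    rw [integral_diffraction f.summable_latPt.norm h3,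
      integral_autocorrelation (𝓕 f).integrable (by simpa only [one_mul] using h1) h2, h4,
      f.tsum_latPt_eq_tsum_fourier, f.integral_fourier_eq_apply_zero]
    simp only [one_mul]
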